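/- Suppose all the tau functions are nonzero and satisfy the bilinear equations ⟨2,i⟩ for 1 ≤ i ≤ n−1. Set x = [λ; τ3, W, τ2] and y = [κ; τ2, N, τ1]. Then: 1/x_1 + 1/ȳ_1 = β·τ0_1/(τ1_0·τ3_0); 1/x_2 + 1/ȳ_2 = β·τ0_2·τ2_0·τ2_1/(N_1·W_1); 1/x_i + 1/ȳ_i = β·τ0_i·τ2_{i−1}/(N_{i−1}·W_{i−1}) for 3 ≤ i ≤ n−2; and y_n/x_{n−1} + 1/ȳ_{n−1} = β·τ0_{n−1}·τ1_n·τ2_{n−2}·τ2_{n−1}/(κ_n·N_{n−2}·W_{n−2}·τ1_{n−1}·τ2_n). -/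

import Mathlib

/-- The `D^(1)_n` bilinear equation `⟨J,i⟩` on the tau functions. -/
def BE {F : Type*} [Field F] (n : ℕ)
    (lam lamb kap kapb S W N E t0 t1 t2 t3 t4 : ℕ → F)
    (α β : F) (J i : ℕ) : Prop :=
  if J = 1 then
    if i = 0 then kapb 1 * N 1 * t4 1 - lamb 1 * E 1 * t2 1 = α * t0 0 * t1 0
    else if i = 1 then kap 1 * N 1 * t4 0 - lam 1 * E 1 * t2 0 = α * t0 1 * t1 1
    else if i = n - 1 then
      kap (n - 1) * kap n * E (n - 2) * t2 n - lam (n - 1) * lam n * N (n - 2) * t4 n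
        = α * t0 (n - 1) * t1 n
    else if i = n then
      kap (n - 1) * E (n - 2) * t2 (n - 1) - lam (n - 1) * N (n - 2) * t4 (n - 1)
        = α * t0 n * t1 (n - 1)
    else kap i * E (i - 1) * N i - lam i * N (i - 1) * E i = α * t0 i * t1 i
  else if J = 2 then
    if i = 0 then kap 1 * N 1 * t3 1 + lamb 1 * W 1 * t1 1 = β * t0 0 * t2 0
    else if i = 1 then kapb 1 * N 1 * t3 0 + lam 1 * W 1 * t1 0 = β * t0 1 * t2 1
    else if i = n - 1 then
      kap n * kapb (n - 1) * W (n - 2) * t1 (n - 1) + lam (n - 1) * N (n - 2) * t3 (n - 1)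
        = β * t0 (n - 1) * t2 (n - 1)
    else if i = n then
      kapb (n - 1) * W (n - 2) * t1 n + lam (n - 1) * lam n * N (n - 2) * t3 n
        = β * t0 n * t2 n
    else kapb i * W (i - 1) * N i + lam i * N (i - 1) * W i = β * t0 i * t2 i
  else if J = 3 then
    if i = 0 then kap 1 * S 1 * t2 1 - lam 1 * W 1 * t4 1 = α * t0 0 * t3 0
    else if i = 1 then kapb 1 * S 1 * t2 0 - lamb 1 * W 1 * t4 0 = α * t0 1 * t3 1
    else if i = n - 1 then
      kapb (n - 1) * W (n - 2) * t4 n - lamb (n - 1) * S (n - 2) * t2 n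
        = α * t0 (n - 1) * t3 n
    else if i = n then
      kap n * kapb (n - 1) * W (n - 2) * t4 (n - 1) - lam n * lamb (n - 1) * S (n - 2) * t2 (n - 1)
        = α * t0 n * t3 (n - 1)
    else kapb i * W (i - 1) * S i - lamb i * S (i - 1) * W i = α * t0 i * t3 i
  else if J = 4 then
    if i = 0 then kapb 1 * S 1 * t1 1 + lam 1 * E 1 * t3 1 = β * t0 0 * t4 0
    else if i = 1 then kap 1 * S 1 * t1 0 + lamb 1 * E 1 * t3 0 = β * t0 1 * t4 1
    else if i = n - 1 then
      kap (n - 1) * E (n - 2) * t3 (n - 1) + lam n * lamb (n - 1) * S (n - 2) * t1 (n - 1)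
        = β * t0 (n - 1) * t4 (n - 1)
    else if i = n then
      kap (n - 1) * kap n * E (n - 2) * t3 n + lamb (n - 1) * S (n - 2) * t1 n
        = β * t0 n * t4 n
    else kap i * E (i - 1) * S i + lamb i * S (i - 1) * E i = β * t0 i * t4 i
  else True

/-- The level `ℓ(x)` of an element of `B`, represented by the pair of families
`x = (x_1,…,x_n)` and `xb = (x̄_1,…,x̄_{n-1})`. -/
def lev {F : Type*} [Field F] (n : ℕ) (x xb : ℕ → F) : F :=
  (∏ i ∈ Finset.Icc 1 n, x i) * ∏ i ∈ Finset.Icc 1 (n - 1), xb i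

/-- The functions `V_0, V_1, …, V_{n-1}` of the `D^(1)_n` tropical `R`. -/
def Vf {F : Type*} [Field F] (n : ℕ) (x xb y yb : ℕ → F) : ℕ → F
  | 0 =>
      lev n x xb * (y 1 / yb 1)
      + lev n x xb *
          ∑ m ∈ Finset.Icc 2 (n - 1), (∏ i ∈ Finset.Icc 1 (m - 1), y i / x i) * (1 + y m / yb m)
      + x n * y n * ∏ i ∈ Finset.Icc 1 (n - 1), xb i * y i
      + lev n y yb * (xb 1 / x 1)
      + lev n y yb *
          ∑ m ∈ Finset.Icc 2 (n - 1), (∏ i ∈ Finset.Icc 1 (m - 1), xb i / yb i) * (1 + xb m / x m)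
      + ∏ i ∈ Finset.Icc 1 (n - 1), xb i * y i
  | (i + 1) =>
      if i + 1 = n - 1 then
        (yb (i + 1) / y n) * (y n * Vf n x xb y yb i / xb (i + 1)
          + (lev n x xb - lev n y yb) * (y n / x (i + 1) + 1 / yb (i + 1)))
      else
        yb (i + 1) * (Vf n x xb y yb i / xb (i + 1)
          + (lev n x xb - lev n y yb) * (1 / x (i + 1) + 1 / yb (i + 1)))

/-- `σ_1` (first component): swap the indices `1` of the two families. -/
def sw1 {F : Type*} (x xb : ℕ → F) : ℕ → F := fun i => if i = 1 then xb 1 else x i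

/-- `σ_n` on the unbarred family. -/
def snx {F : Type*} [Field F] (n : ℕ) (x : ℕ → F) : ℕ → F :=
  fun i => if i = n - 1 then x (n - 1) * x n else if i = n then (x n)⁻¹ else x i

/-- `σ_n` on the barred family. -/
def snxb {F : Type*} [Field F] (n : ℕ) (x xb : ℕ → F) : ℕ → F :=
  fun i => if i = n - 1 then xb (n - 1) * x n else xb i

/-- `σ✶` (unbarred part of the first component of `σ✶(x,y)`, built from `y`). -/
def stx {F : Type*} (n : ℕ) (y yb : ℕ → F) : ℕ → F := fun i => if i = n then y n else yb i

/-- `V_i^{σ_1}`. -/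
def Vs1 {F : Type*} [Field F] (n : ℕ) (x xb y yb : ℕ → F) : ℕ → F :=
  Vf n (sw1 x xb) (sw1 xb x) (sw1 y yb) (sw1 yb y)

/-- `V_i^{σ_n}`. -/
def Vsn {F : Type*} [Field F] (n : ℕ) (x xb y yb : ℕ → F) : ℕ → F :=
  Vf n (snx n x) (snxb n x xb) (snx n y) (snxb n y yb)

/-- `V_i^{σ✶}`. -/
def Vst {F : Type*} [Field F] (n : ℕ) (x xb y yb : ℕ → F) : ℕ → F :=
  Vf n (stx n y yb) y (stx n x xb) x

/-- The functions `U_1, …, U_{n-1}` of the `D^(1)_n` tropical `R`. -/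
def Uf {F : Type*} [Field F] (n : ℕ) (x xb y yb : ℕ → F) : ℕ → F := fun i =>
  if i = 1 then Vf n x xb y yb 0 * Vs1 n x xb y yb 0
  else if i = n - 1 then Vf n x xb y yb (n - 1) * Vst n x xb y yb (n - 1)
  else (1 / x i + 1 / yb i)⁻¹ *
    (Vf n x xb y yb i * Vst n x xb y yb (i - 1) / y i
      + Vf n x xb y yb (i - 1) * Vst n x xb y yb i / xb i)

/-- unbarred part `x'` of the output of the tropical `R`. -/
def Rx {F : Type*} [Field F] (n : ℕ) (x xb y yb : ℕ → F) : ℕ → F := fun i =>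
  if i = 1 then y 1 * Vs1 n x xb y yb 0 / Vf n x xb y yb 1
  else if i = n then y n * Vf n x xb y yb (n - 1) / Vsn n x xb y yb (n - 1)
  else y i * Vf n x xb y yb (i - 1) * Uf n x xb y yb i
        / (Vf n x xb y yb i * Uf n x xb y yb (i - 1))

/-- barred part `x̄'` of the output of the tropical `R`. -/
def Rxb {F : Type*} [Field F] (n : ℕ) (x xb y yb : ℕ → F) : ℕ → F := fun i =>
  if i = 1 then yb 1 * Vf n x xb y yb 0 / Vf n x xb y yb 1
  else yb i * Vf n x xb y yb (i - 1) / Vf n x xb y yb i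

/-- unbarred part `y'` of the output of the tropical `R`. -/
def Ry {F : Type*} [Field F] (n : ℕ) (x xb y yb : ℕ → F) : ℕ → F := fun i =>
  if i = 1 then x 1 * Vf n x xb y yb 0 / Vst n x xb y yb 1
  else if i = n then x n * Vsn n x xb y yb (n - 1) / Vf n x xb y yb (n - 1)
  else x i * Vst n x xb y yb (i - 1) / Vst n x xb y yb i

/-- barred part `ȳ'` of the output of the tropical `R`. -/
def Ryb {F : Type*} [Field F] (n : ℕ) (x xb y yb : ℕ → F) : ℕ → F := fun i =>
  if i = 1 then xb 1 * Vs1 n x xb y yb 0 / Vst n x xb y yb 1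
  else xb i * Vst n x xb y yb (i - 1) * Uf n x xb y yb i
        / (Vst n x xb y yb i * Uf n x xb y yb (i - 1))

/-- Admissibility: all the quantities `V_i`, `U_i` and their `σ`-transforms appearing in
the formulas of the tropical `R` are nonzero. -/
def Adm {F : Type*} [Field F] (n : ℕ) (x xb y yb : ℕ → F) : Prop :=
  (∀ i ≤ n - 1, Vf n x xb y yb i ≠ 0) ∧
  (∀ i ≤ n - 1, Vst n x xb y yb i ≠ 0) ∧
  Vs1 n x xb y yb 0 ≠ 0 ∧
  Vsn n x xb y yb (n - 1) ≠ 0 ∧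
  (∀ i, 1 ≤ i → i ≤ n - 1 → Uf n x xb y yb i ≠ 0)

/-- The unbarred part of `[μ; τ, C, τ']`. -/
def brkX {F : Type*} [Field F] (n : ℕ) (μ τ C τ' : ℕ → F) : ℕ → F := fun i =>
  if i = 1 then (μ 1)⁻¹ * (τ 0 * τ' 1 / C 1)
  else if i = 2 then (μ 2)⁻¹ * (C 1 * τ' 2 / (C 2 * τ' 0 * τ' 1))
  else if i = n - 1 then (μ (n - 1))⁻¹ * (C (n - 2) * τ' (n - 1) / (τ (n - 1) * τ' (n - 2)))
  else if i = n then (μ n)⁻¹ * (τ (n - 1) * τ' n / (τ n * τ' (n - 1)))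
  else (μ i)⁻¹ * (C (i - 1) * τ' i / (C i * τ' (i - 1)))

/-- The barred part of `[μ; τ, C, τ']` (here `μb` is the barred part of `μ`). -/
def brkXb {F : Type*} [Field F] (n : ℕ) (μb τ C τ' : ℕ → F) : ℕ → F := fun i =>
  if i = 1 then (μb 1)⁻¹ * (τ 1 * τ' 0 / C 1)
  else if i = 2 then (μb 2)⁻¹ * (C 1 * τ 2 / (C 2 * τ 0 * τ 1))
  else if i = n - 1 then (μb (n - 1))⁻¹ * (C (n - 2) * τ n / (τ (n - 2) * τ' n))
  else (μb i)⁻¹ * (C (i - 1) * τ i / (C i * τ (i - 1)))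

theorem stmt18 {F : Type*} [Field F] (n : ℕ) (hn : 4 ≤ n)
    (lam lamb kap kapb : ℕ → F) (α β : F)
    (hlam : ∀ i, 1 ≤ i → i ≤ n → lam i ≠ 0)
    (hlamb : ∀ i, 1 ≤ i → i ≤ n - 1 → lamb i ≠ 0)
    (hkap : ∀ i, 1 ≤ i → i ≤ n → kap i ≠ 0)
    (hkapb : ∀ i, 1 ≤ i → i ≤ n - 1 → kapb i ≠ 0)
    (hα : α ≠ 0) (hβ : β ≠ 0)
    (S W N E t0 t1 t2 t3 t4 : ℕ → F)
    (hS : ∀ i, 1 ≤ i → i ≤ n - 2 → S i ≠ 0)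
    (hW : ∀ i, 1 ≤ i → i ≤ n - 2 → W i ≠ 0)
    (hN : ∀ i, 1 ≤ i → i ≤ n - 2 → N i ≠ 0)
    (hE : ∀ i, 1 ≤ i → i ≤ n - 2 → E i ≠ 0)
    (ht0 : ∀ i ≤ n, t0 i ≠ 0) (ht1 : ∀ i ≤ n, t1 i ≠ 0) (ht2 : ∀ i ≤ n, t2 i ≠ 0)
    (ht3 : ∀ i ≤ n, t3 i ≠ 0) (ht4 : ∀ i ≤ n, t4 i ≠ 0)
    (heqs : ∀ i, 1 ≤ i → i ≤ n - 1 →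
      BE n lam lamb kap kapb S W N E t0 t1 t2 t3 t4 α β 2 i)
    (x xb y yb : ℕ → F)
    (hx : x = brkX n lam t3 W t2) (hxb : xb = brkXb n lamb t3 W t2)
    (hy : y = brkX n kap t2 N t1) (hyb : yb = brkXb n kapb t2 N t1) :
    1 / x 1 + 1 / yb 1 = β * t0 1 / (t1 0 * t3 0) ∧
    1 / x 2 + 1 / yb 2 = β * t0 2 * t2 0 * t2 1 / (N 1 * W 1) ∧
    (∀ i, 3 ≤ i → i ≤ n - 2 →
      1 / x i + 1 / yb i = β * t0 i * t2 (i - 1) / (N (i - 1) * W (i - 1))) ∧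
    y n / x (n - 1) + 1 / yb (n - 1)
      = β * t0 (n - 1) * t1 n * t2 (n - 2) * t2 (n - 1)
        / (kap n * N (n - 2) * W (n - 2) * t1 (n - 1) * t2 n) := by
  subst hx hy hyb
  refine ⟨?_, ?_, fun i hi hin => ?_, ?_⟩
  · have h := heqs 1 le_rfl (by omega)
    simp only [BE, OfNat.ofNat_ne_one, one_ne_zero, if_true, if_false] at h
    have := ht1 0 (by omega)
    have := ht2 1 (by omega)
    have := ht3 0 (by omega)
    simp only [brkX, brkXb, if_true]
    field_simp
    linear_combination h
  · have h := heqs 2 (by omega) (by omega)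
    simp only [BE, OfNat.ofNat_ne_one, OfNat.ofNat_ne_zero, if_true, if_false,
      show 2 ≠ n - 1 by omega, show 2 ≠ n by omega, Nat.add_one_sub_one] at h
    have := hW 1 le_rfl (by omega)
    have := hN 1 le_rfl (by omega)
    have := ht2 0 (by omega)
    have := ht2 1 (by omega)
    have := ht2 2 (by omega)
    simp only [brkX, brkXb, OfNat.ofNat_ne_one, if_true, if_false]
    field_simp
    linear_combination h
  · have h := heqs i (by omega) (by omega)
    simp only [BE, OfNat.ofNat_ne_one, if_true, if_false, show i ≠ 0 by omega,
      show i ≠ 1 by omega, show i ≠ n - 1 by omega, show i ≠ n by omega] at h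
    have := hW (i - 1) (by omega) (by omega)
    have := hN (i - 1) (by omega) (by omega)
    have := ht2 (i - 1) (by omega)
    have := ht2 i (by omega)
    simp only [brkX, brkXb, if_false, show i ≠ 1 by omega, show i ≠ 2 by omega,
      show i ≠ n - 1 by omega, show i ≠ n by omega]
    field_simp
    linear_combination h
  · have h := heqs (n - 1) (by omega) le_rfl
    simp only [BE, OfNat.ofNat_ne_one, if_true, if_false, show n - 1 ≠ 0 by omega,
      show n - 1 ≠ 1 by omega] at h
    have := hkap n (by omega) le_rfl
    have := hW (n - 2) (by omega) le_rfl
    have := hN (n - 2) (by omega) le_rfl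
    have := ht1 (n - 1) (by omega)
    have := ht1 n le_rfl
    have := ht2 (n - 2) (by omega)
    have := ht2 (n - 1) (by omega)
    have := ht2 n le_rfl
    simp only [brkX, brkXb, if_true, if_false, show n - 1 ≠ 1 by omega,
      show n - 1 ≠ 2 by omega, show n ≠ 1 by omega, show n ≠ 2 by omega,
      show n ≠ n - 1 by omega]
    field_simp
    linear_combination h
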